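/- Let X be a regular curve and let G be a group acting on X by homeomorphisms such that the action is sensitive. Then there is a nonempty G-invariant open set V ⊆ X such that the restricted action of G on V is topologically transitive. -/

import Mathlib

open Set Metric

theorem IsPreconnected.subset_of_disjoint_frontier {X : Type*} [TopologicalSpace X] {C V : Set X}
    (hC : IsPreconnected C) (hVo : IsOpen V) (hV : (C ∩ V).Nonempty)
    (hd : Disjoint C (frontier V)) : C ⊆ V := by
  refine hC.subset_of_closure_inter_subset hVo hV fun x hx => ?_
  by_contra h
  exact disjoint_left.1 hd hx.2 ⟨hx.1, by rwa [hVo.interior_eq]⟩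

/-- In a compact rim-finite metric space, for every `ε > 0` some finite set meets every connected
set of diameter larger than `ε`. -/
theorem exists_finite_inter_nonempty_of_lt_diam {X : Type*} [MetricSpace X] [CompactSpace X]
    (hreg : ∀ (x : X) (U : Set X), IsOpen U → x ∈ U →
      ∃ V : Set X, IsOpen V ∧ x ∈ V ∧ V ⊆ U ∧ (frontier V).Finite)
    {ε : ℝ} (hε : 0 < ε) :
    ∃ F : Set X, F.Finite ∧
      ∀ C : Set X, IsPreconnected C → ε < diam C → (C ∩ F).Nonempty := by
  choose V hVo hxV hVb hVf using fun x : X =>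
    hreg x (ball x (ε / 2)) isOpen_ball (mem_ball_self (half_pos hε))
  obtain ⟨t, ht⟩ := isCompact_univ.elim_finite_subcover V hVo
    fun x _ => mem_iUnion.2 ⟨x, hxV x⟩
  refine ⟨⋃ x ∈ t, frontier (V x), t.finite_toSet.biUnion fun x _ => hVf x, fun C hC hlt => ?_⟩
  by_contra hF
  obtain ⟨y, hy⟩ : C.Nonempty := by
    by_contra h
    rw [not_nonempty_iff_eq_empty.1 h, diam_empty] at hlt
    exact hlt.not_gt hε
  obtain ⟨x, hxt, hyx⟩ := mem_iUnion₂.1 (ht (mem_univ y))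
  have hCV : C ⊆ V x := hC.subset_of_disjoint_frontier (hVo x) ⟨y, hy, hyx⟩ <|
    disjoint_left.2 fun z hz hzf => hF ⟨z, hz, mem_iUnion₂.2 ⟨x, hxt, hzf⟩⟩
  have h1 : diam C ≤ diam (ball x (ε / 2)) := diam_mono (hCV.trans (hVb x)) isBounded_ball
  have h2 : diam (ball x (ε / 2)) ≤ 2 * (ε / 2) := diam_ball (half_pos hε).le
  linarith

/-- In a connected space, a relatively clopen subset of `closure V` is determined by its trace on
the frontier of the open set `V`, provided that this frontier is nonempty. -/
theorem injOn_isClopen_closure_inter_frontier {X : Type*} [TopologicalSpace X]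
    [PreconnectedSpace X] {V : Set X} (hV : IsOpen V) (hne : (frontier V).Nonempty) :
    InjOn (fun Q : Set (closure V) => Subtype.val '' Q ∩ frontier V) {Q | IsClopen Q} := by
  intro Q hQ Q' hQ' heq
  have hD : IsClopen (symmDiff Q Q') := by
    rw [Set.symmDiff_def]
    exact (hQ.diff hQ').union (hQ'.diff hQ)
  have hdisj : ∀ x : closure V, x ∈ symmDiff Q Q' → x.1 ∉ frontier V := by
    intro x hx hxf
    have hiff : x ∈ Q ↔ x ∈ Q' := by
      have := Set.ext_iff.1 heq x.1
      simpa [hxf] using this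
    rcases hx with h | h
    · exact h.2 (hiff.1 h.1)
    · exact h.2 (hiff.2 h.1)
  have hclosed : IsClosed (Subtype.val '' symmDiff Q Q') :=
    isClosed_closure.isClosedEmbedding_subtypeVal.isClosedMap _ hD.1
  have hopen : IsOpen (Subtype.val '' symmDiff Q Q') := by
    obtain ⟨O, hO, hOD⟩ := isOpen_induced_iff.1 hD.2
    have : Subtype.val '' symmDiff Q Q' = O ∩ V := by
      ext x
      constructor
      · rintro ⟨y, hy, rfl⟩
        refine ⟨by rw [← hOD] at hy; exact hy, ?_⟩
        by_contra hyV
        exact hdisj y hy ⟨y.2, by rwa [hV.interior_eq]⟩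
      · rintro ⟨hxO, hxV⟩
        exact ⟨⟨x, subset_closure hxV⟩, by rw [← hOD]; exact hxO, rfl⟩
    rw [this]
    exact hO.inter hV
  rcases isClopen_iff.1 ⟨hclosed, hopen⟩ with h | h
  · exact symmDiff_eq_bot.1 (image_eq_empty.1 h)
  · obtain ⟨b, hb⟩ := hne
    obtain ⟨y, hy, rfl⟩ : b ∈ Subtype.val '' symmDiff Q Q' := h ▸ mem_univ b
    exact (hdisj y hy hb).elim

/-- In a compact connected Hausdorff space, the closure of a nonempty open set with finite frontier
contains a connected set with nonempty interior. -/
theorem exists_isPreconnected_subset_closure_of_finite_frontier {X : Type*} [TopologicalSpace X]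
    [CompactSpace X] [T2Space X] [PreconnectedSpace X] {V : Set X} (hV : IsOpen V)
    (hVne : V.Nonempty) (hfin : (frontier V).Finite) :
    ∃ C ⊆ closure V, IsPreconnected C ∧ (interior C).Nonempty := by
  rcases (frontier V).eq_empty_or_nonempty with h | hne
  · have hu : V = univ := (isClopen_iff_frontier_eq_empty.2 h).eq_univ hVne
    subst hu
    exact ⟨univ, subset_closure, isPreconnected_univ, by simpa using hVne⟩
  · have : CompactSpace (closure V) := isCompact_iff_compactSpace.1 isClosed_closure.isCompact
    have hQfin : {Q : Set (closure V) | IsClopen Q}.Finite :=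
      Finite.of_injOn (fun _ _ => inter_subset_right) (injOn_isClopen_closure_inter_frontier hV hne)
        hfin.finite_subsets
    obtain ⟨x, hx⟩ := hVne
    have hopen : IsOpen (connectedComponent (⟨x, subset_closure hx⟩ : closure V)) := by
      rw [connectedComponent_eq_iInter_isClopen]
      have : Finite {Q : Set (closure V) // IsClopen Q ∧ (⟨x, subset_closure hx⟩ : closure V) ∈ Q} :=
        (hQfin.subset fun Q hQ => hQ.1 :
          {Q : Set (closure V) | IsClopen Q ∧ (⟨x, subset_closure hx⟩ : closure V) ∈ Q}.Finite)
      exact isOpen_iInter_of_finite fun Q => Q.2.1.2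
    obtain ⟨O, hO, hOC⟩ := isOpen_induced_iff.1 hopen
    refine ⟨Subtype.val '' connectedComponent (⟨x, subset_closure hx⟩ : closure V), ?_,
      isPreconnected_connectedComponent.image _ continuous_subtype_val.continuousOn, x, ?_⟩
    · rintro _ ⟨y, -, rfl⟩
      exact y.2
    · refine mem_interior.2 ⟨O ∩ V, ?_, hO.inter hV, ?_, hx⟩
      · rintro y ⟨hyO, hyV⟩
        exact ⟨⟨y, subset_closure hyV⟩, by rw [← hOC]; exact hyO, rfl⟩
      · have : (⟨x, subset_closure hx⟩ : closure V) ∈ Subtype.val ⁻¹' O := by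
          rw [hOC]; exact mem_connectedComponent
        exact this

/-- A group action is topologically transitive on open subsets of an orbit closure. -/
theorem exists_smul_image_inter_nonempty_of_subset_closure_orbit {X G : Type*} [TopologicalSpace X]
    [Group G] [MulAction G X] {p : X} {U₁ U₂ : Set X} (h₁ : IsOpen U₁) (h₂ : IsOpen U₂)
    (hs₁ : U₁ ⊆ closure (MulAction.orbit G p)) (hs₂ : U₂ ⊆ closure (MulAction.orbit G p))
    (hn₁ : U₁.Nonempty) (hn₂ : U₂.Nonempty) :
    ∃ g : G, ((fun x => g • x) '' U₁ ∩ U₂).Nonempty := by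
  obtain ⟨x, hx⟩ := hn₁
  obtain ⟨y, hy⟩ := hn₂
  obtain ⟨_, ha, a, rfl⟩ := mem_closure_iff.1 (hs₁ hx) U₁ h₁ hx
  obtain ⟨_, hb, b, rfl⟩ := mem_closure_iff.1 (hs₂ hy) U₂ h₂ hy
  exact ⟨b * a⁻¹, b • p, ⟨a • p, ha, by simp [mul_smul]⟩, hb⟩

open scoped Pointwise in
theorem smul_interior_closure_orbit {X G : Type*} [TopologicalSpace X] [Group G] [MulAction G X]
    [ContinuousConstSMul G X] (g : G) (p : X) :
    g • interior (closure (MulAction.orbit G p)) = interior (closure (MulAction.orbit G p)) := by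
  rw [← interior_smul, ← closure_smul, MulAction.smul_orbit]

/-- A sensitive action of a group `G` by homeomorphisms on a regular curve
admits a nonempty `G`-invariant open set `V` on which the restricted action is
topologically transitive. -/
theorem sensitive_action_has_transitive_open_subsystem
    {X : Type*} [MetricSpace X] [CompactSpace X] [ConnectedSpace X]
    (hreg : ∀ (x : X) (U : Set X), IsOpen U → x ∈ U →
      ∃ V : Set X, IsOpen V ∧ x ∈ V ∧ V ⊆ U ∧ (frontier V).Finite)
    {G : Type*} [Group G] [MulAction G X]
    (hcont : ∀ g : G, Continuous fun x : X => g • x)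
    (hsens : ∃ c > (0 : ℝ), ∀ U : Set X, IsOpen U → U.Nonempty →
      ∃ g : G, c < Metric.diam ((fun x => g • x) '' U)) :
    ∃ V : Set X, IsOpen V ∧ V.Nonempty ∧
      (∀ g : G, (fun x => g • x) '' V ⊆ V) ∧
      (∀ U1 U2 : Set X, IsOpen U1 → IsOpen U2 → U1 ⊆ V → U2 ⊆ V →
        U1.Nonempty → U2.Nonempty →
        ∃ g : G, ((fun x => g • x) '' U1 ∩ U2).Nonempty) := by
  obtain ⟨c, hc, hsens⟩ := hsens
  have : ContinuousConstSMul G X := ⟨hcont⟩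
  obtain ⟨F, hF, hFC⟩ := exists_finite_inter_nonempty_of_lt_diam hreg hc
  have hdense : ∀ x, x ∈ ⋃ p ∈ F, closure (MulAction.orbit G p) := by
    intro x
    rw [← hF.closure_biUnion]
    refine mem_closure_iff.2 fun U hU hxU => ?_
    obtain ⟨W, hxW, hW, hWU⟩ := exists_mem_nhds_isClosed_subset (hU.mem_nhds hxU)
    obtain ⟨V, hV, hxV, hVW, hVf⟩ :=
      hreg x (interior W) isOpen_interior (mem_interior_iff_mem_nhds.2 hxW)
    obtain ⟨C, hCV, hC, hCi⟩ :=
      exists_isPreconnected_subset_closure_of_finite_frontier hV ⟨x, hxV⟩ hVf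
    obtain ⟨g, hg⟩ := hsens _ isOpen_interior hCi
    have hlt : c < diam ((fun x => g • x) '' C) :=
      hg.trans_le (diam_mono (image_mono interior_subset) (isBounded_of_compactSpace))
    obtain ⟨_, ⟨y, hy, rfl⟩, hyF⟩ := hFC _ (hC.image _ (hcont g).continuousOn) hlt
    exact ⟨y, hWU (hW.closure_subset_iff.2 (hVW.trans interior_subset) (hCV hy)),
      mem_iUnion₂.2 ⟨g • y, hyF, g⁻¹, by simp⟩⟩
  obtain ⟨p, hp⟩ : ∃ p, (interior (closure (MulAction.orbit G p))).Nonempty := by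
    have hd := dense_biUnion_interior_of_closed
      (fun p (_ : p ∈ F) => isClosed_closure (s := MulAction.orbit G p)) hF.countable
      (eq_univ_of_forall hdense)
    obtain ⟨x, hx⟩ := hd.nonempty
    obtain ⟨p, -, hp⟩ := mem_iUnion₂.1 hx
    exact ⟨p, x, hp⟩
  refine ⟨interior (closure (MulAction.orbit G p)), isOpen_interior, hp, fun g => ?_,
    fun U₁ U₂ h₁ h₂ hs₁ hs₂ => exists_smul_image_inter_nonempty_of_subset_closure_orbit h₁ h₂
      (hs₁.trans interior_subset) (hs₂.trans interior_subset)⟩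
  exact (smul_interior_closure_orbit g p).subset
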